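/- arXiv:1809.03709 — 2 statements merged into one kernel-verified Lean document; each statement's English description precedes it below -/
import Mathlib

section
/- Jensen's inequality for interval-valued functions (time scale 𝕋 = ℝ). Let a < b and c < d be real numbers, let g : ℝ → ℝ be continuous on [a,b] with g(t) ∈ (c,d) for all t ∈ [a,b], and let h : ℝ → ℝ be continuous on [a,b] with H := ∫ s in a..b, |h s| > 0. Let f₁, f₂ : ℝ → ℝ be continuous on (c,d) with 0 < f₁(x) ≤ f₂(x) for all x ∈ (c,d), and suppose f₁ is convex on Set.Ioo c d and f₂ is concave on Set.Ioo c d (so that f = [f₁, f₂] is a positive convex interval-valued function). Set A := (∫ s in a..b, |h s| * g s) / H. Then f₁(A) ≤ (∫ s in a..b, |h s| * f₁ (g s)) / H and (∫ s in a..b, |h s| * f₂ (g s)) / H ≤ f₂(A); that is, the interval [(∫ |h| f₁∘g)/H, (∫ |h| f₂∘g)/H] is contained in the interval [f₁(A), f₂(A)]. -/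
open MeasureTheory

/-- **Jensen's inequality** for an integral over `[a, b]` with weight `|h|`. -/
theorem ConvexOn.map_weighted_intervalIntegral_le {a b : ℝ} {S : Set ℝ} {g h f : ℝ → ℝ}
    (hab : a ≤ b) (hg : ContinuousOn g (Set.Icc a b)) (hgS : Set.MapsTo g (Set.Icc a b) S)
    (hh : ContinuousOn h (Set.Icc a b)) (hH : 0 < ∫ s in a..b, |h s|)
    (hf : ContinuousOn f S) (hconv : ConvexOn ℝ S f) :
    f ((∫ s in a..b, |h s| * g s) / (∫ s in a..b, |h s|)) ≤
      (∫ s in a..b, |h s| * f (g s)) / (∫ s in a..b, |h s|) := by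
  set μ : Measure ℝ :=
    (volume.restrict (Set.Ioc a b)).withDensity fun s => (‖h s‖₊ : ENNReal) with hμ
  have hmeas : AEMeasurable (fun s => ‖h s‖₊) (volume.restrict (Set.Ioc a b)) :=
    ((hh.mono Set.Ioc_subset_Icc_self).aemeasurable measurableSet_Ioc).nnnorm
  have integral_eq (u : ℝ → ℝ) : ∫ s, u s ∂μ = ∫ s in a..b, |h s| * u s := by
    rw [hμ, integral_withDensity_eq_integral_smul₀ hmeas, intervalIntegral.integral_of_le hab]
    rfl
  have integrable (u : ℝ → ℝ) (hu : ContinuousOn u (Set.Icc a b)) : Integrable u μ := by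
    rw [hμ, integrable_withDensity_iff_integrable_smul₀ hmeas]
    exact ((hh.abs.mul hu).integrableOn_Icc).mono_set Set.Ioc_subset_Icc_self
  have hfin : IsFiniteMeasure μ :=
    (integrable_const_iff_isFiniteMeasure one_ne_zero).1 (integrable _ continuousOn_const)
  have hmass : μ.real Set.univ = ∫ s in a..b, |h s| := by
    simpa using integral_eq fun _ => 1
  have hne : NeZero μ := ⟨fun h0 => by simp [← hmass, h0] at hH⟩
  have hmem : ∀ᵐ s ∂μ, g s ∈ g '' Set.Icc a b := by
    refine (withDensity_absolutelyContinuous _ _).ae_le ?_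
    filter_upwards [ae_restrict_mem measurableSet_Ioc] with s hs
    exact Set.mem_image_of_mem g (Set.Ioc_subset_Icc_self hs)
  have himage : Convex ℝ (g '' Set.Icc a b) :=
    (isPreconnected_Icc.image g hg).ordConnected.convex
  have key := (hconv.subset hgS.image_subset himage).map_average_le
    (hf.mono hgS.image_subset) (isCompact_Icc.image_of_continuousOn hg).isClosed hmem
    (integrable g hg) (integrable _ (hf.comp hg hgS))
  simpa only [average_eq, hmass, integral_eq, smul_eq_mul, inv_mul_eq_div] using key


theorem interval_jensen_convex (a b c d : ℝ) (hab : a < b) (hcd : c < d)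
    (g h f₁ f₂ : ℝ → ℝ)
    (hg : ContinuousOn g (Set.Icc a b))
    (hgmem : ∀ t ∈ Set.Icc a b, g t ∈ Set.Ioo c d)
    (hh : ContinuousOn h (Set.Icc a b))
    (hH : 0 < ∫ s in a..b, |h s|)
    (hf₁ : ContinuousOn f₁ (Set.Ioo c d))
    (hf₂ : ContinuousOn f₂ (Set.Ioo c d))
    (hpos : ∀ x ∈ Set.Ioo c d, 0 < f₁ x)
    (hle : ∀ x ∈ Set.Ioo c d, f₁ x ≤ f₂ x)
    (hconv : ConvexOn ℝ (Set.Ioo c d) f₁)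
    (hconc : ConcaveOn ℝ (Set.Ioo c d) f₂) :
    f₁ ((∫ s in a..b, |h s| * g s) / (∫ s in a..b, |h s|)) ≤
        (∫ s in a..b, |h s| * f₁ (g s)) / (∫ s in a..b, |h s|) ∧
      (∫ s in a..b, |h s| * f₂ (g s)) / (∫ s in a..b, |h s|) ≤
        f₂ ((∫ s in a..b, |h s| * g s) / (∫ s in a..b, |h s|)) := by
  refine ⟨hconv.map_weighted_intervalIntegral_le hab.le hg hgmem hh hH hf₁, ?_⟩
  have key := hconc.neg.map_weighted_intervalIntegral_le hab.le hg hgmem hh hH hf₂.neg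
  simpa [neg_div] using key
end

section
/- Hölder's inequality for negative interval-valued functions (time scale 𝕋 = ℝ). Let a < b be real numbers, let h : ℝ → ℝ be continuous on [a,b] with h(s) > 0 for all s ∈ [a,b], and let f₁, f₂, g₁, g₂ : ℝ → ℝ be continuous on [a,b] with f₁(s) ≤ f₂(s) < 0 and g₁(s) ≤ g₂(s) < 0 for all s ∈ [a,b]. Let p, q > 1 be real numbers with 1/p + 1/q = 1. Then ∫ s in a..b, h s * f₂ s * g₂ s ≤ (∫ s in a..b, h s * (-(f₂ s))^p)^(1/p) * (∫ s in a..b, h s * (-(g₂ s))^q)^(1/q), and ∫ s in a..b, h s * f₁ s * g₁ s ≤ (∫ s in a..b, h s * (-(f₁ s))^p)^(1/p) * (∫ s in a..b, h s * (-(g₁ s))^q)^(1/q); these express the interval partial-order inequality ∫ h·f·g ≤ (∫ h·(−f)^p)^(1/p) · (∫ h·(−g)^q)^(1/q) for the negative interval-valued functions f = [f₁,f₂] and g = [g₁,g₂]. -/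
open MeasureTheory Set

/-- A function continuous on `[a, b]` is in every `L^r` over `(a, b]`. -/
lemma ContinuousOn.memLp_restrict_Ioc {a b : ℝ} {f : ℝ → ℝ} (hf : ContinuousOn f (Icc a b))
    (r : ENNReal) : MemLp f r (volume.restrict (Ioc a b)) := by
  obtain ⟨C, hC⟩ := isCompact_Icc.exists_bound_of_continuousOn hf
  refine MemLp.of_bound
    ((hf.mono Ioc_subset_Icc_self).aestronglyMeasurable measurableSet_Ioc) C ?_
  filter_upwards [ae_restrict_mem measurableSet_Ioc] with s hs
  exact hC s (Ioc_subset_Icc_self hs)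

/-- Weighted Hölder inequality for nonnegative continuous functions on `[a, b]`. -/
lemma intervalIntegral_weighted_holder {a b : ℝ} (hab : a ≤ b) {h f g : ℝ → ℝ}
    (hh : ContinuousOn h (Icc a b)) (hf : ContinuousOn f (Icc a b))
    (hg : ContinuousOn g (Icc a b)) (hh0 : ∀ s ∈ Icc a b, 0 ≤ h s)
    (hf0 : ∀ s ∈ Icc a b, 0 ≤ f s) (hg0 : ∀ s ∈ Icc a b, 0 ≤ g s)
    {p q : ℝ} (hpq : p.HolderConjugate q) :
    (∫ s in a..b, h s * f s * g s) ≤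
      (∫ s in a..b, h s * f s ^ p) ^ (1 / p) * (∫ s in a..b, h s * g s ^ q) ^ (1 / q) := by
  have root_continuousOn {r : ℝ} (hr : 0 < r) : ContinuousOn (fun s => h s ^ r⁻¹) (Icc a b) :=
    hh.rpow_const fun _ _ => Or.inr (inv_nonneg.2 hr.le)
  have weight_pow {r : ℝ} (hr : 0 < r) {u : ℝ → ℝ} (hu : ∀ s ∈ Icc a b, 0 ≤ u s) :
      ∫ s in Ioc a b, (h s ^ r⁻¹ * u s) ^ r = ∫ s in Ioc a b, h s * u s ^ r := by
    refine setIntegral_congr_fun measurableSet_Ioc fun s hs => ?_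
    have hs := Ioc_subset_Icc_self hs
    rw [Real.mul_rpow (Real.rpow_nonneg (hh0 s hs) _) (hu s hs),
      Real.rpow_inv_rpow (hh0 s hs) hr.ne']
  have weight_nonneg (r : ℝ) {u : ℝ → ℝ} (hu : ∀ s ∈ Icc a b, 0 ≤ u s) :
      0 ≤ᵐ[volume.restrict (Ioc a b)] fun s => h s ^ r⁻¹ * u s := by
    filter_upwards [ae_restrict_mem measurableSet_Ioc] with s hs
    have hs := Ioc_subset_Icc_self hs
    exact mul_nonneg (Real.rpow_nonneg (hh0 s hs) _) (hu s hs)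
  have split_weight : ∫ s in Ioc a b, h s * f s * g s =
      ∫ s in Ioc a b, (h s ^ p⁻¹ * f s) * (h s ^ q⁻¹ * g s) := by
    refine setIntegral_congr_fun measurableSet_Ioc fun s hs => ?_
    have hs : h s ^ p⁻¹ * h s ^ q⁻¹ = h s := by
      rw [← Real.rpow_add_of_nonneg (hh0 s (Ioc_subset_Icc_self hs))
        (inv_nonneg.2 hpq.pos.le) (inv_nonneg.2 hpq.symm.pos.le),
        hpq.inv_add_inv_eq_one, Real.rpow_one]
    rw [mul_mul_mul_comm, hs, mul_assoc]
  simp only [intervalIntegral.integral_of_le hab]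
  rw [split_weight, ← weight_pow hpq.pos hf0, ← weight_pow hpq.symm.pos hg0]
  exact integral_mul_le_Lp_mul_Lq_of_nonneg hpq (weight_nonneg p hf0) (weight_nonneg q hg0)
    (((root_continuousOn hpq.pos).mul hf).memLp_restrict_Ioc _)
    (((root_continuousOn hpq.symm.pos).mul hg).memLp_restrict_Ioc _)

theorem interval_holder_neg (a b : ℝ) (hab : a < b) (h f₁ f₂ g₁ g₂ : ℝ → ℝ)
    (hh : ContinuousOn h (Set.Icc a b))
    (hhpos : ∀ s ∈ Set.Icc a b, 0 < h s)
    (hf₁ : ContinuousOn f₁ (Set.Icc a b)) (hf₂ : ContinuousOn f₂ (Set.Icc a b))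
    (hg₁ : ContinuousOn g₁ (Set.Icc a b)) (hg₂ : ContinuousOn g₂ (Set.Icc a b))
    (hfle : ∀ s ∈ Set.Icc a b, f₁ s ≤ f₂ s) (hfneg : ∀ s ∈ Set.Icc a b, f₂ s < 0)
    (hgle : ∀ s ∈ Set.Icc a b, g₁ s ≤ g₂ s) (hgneg : ∀ s ∈ Set.Icc a b, g₂ s < 0)
    (p q : ℝ) (hp : 1 < p) (hq : 1 < q) (hpq : 1 / p + 1 / q = 1) :
    (∫ s in a..b, h s * f₂ s * g₂ s) ≤
        (∫ s in a..b, h s * (-(f₂ s)) ^ p) ^ (1 / p) *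
          (∫ s in a..b, h s * (-(g₂ s)) ^ q) ^ (1 / q) ∧
      (∫ s in a..b, h s * f₁ s * g₁ s) ≤
        (∫ s in a..b, h s * (-(f₁ s)) ^ p) ^ (1 / p) *
          (∫ s in a..b, h s * (-(g₁ s)) ^ q) ^ (1 / q) := by
  have hpq' : p.HolderConjugate q :=
    Real.holderConjugate_iff.2 ⟨hp, by simpa only [one_div] using hpq⟩
  have holder_of_nonpos {f g : ℝ → ℝ} (hf : ContinuousOn f (Icc a b))
      (hg : ContinuousOn g (Icc a b)) (hf0 : ∀ s ∈ Icc a b, f s ≤ 0)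
      (hg0 : ∀ s ∈ Icc a b, g s ≤ 0) :
      (∫ s in a..b, h s * f s * g s) ≤
        (∫ s in a..b, h s * (-(f s)) ^ p) ^ (1 / p) *
          (∫ s in a..b, h s * (-(g s)) ^ q) ^ (1 / q) := by
    simpa only [mul_neg, neg_mul, neg_neg] using
      intervalIntegral_weighted_holder hab.le hh hf.fun_neg hg.fun_neg
        (fun s hs => (hhpos s hs).le) (fun s hs => neg_nonneg.2 (hf0 s hs))
        (fun s hs => neg_nonneg.2 (hg0 s hs)) hpq'
  exact ⟨holder_of_nonpos hf₂ hg₂ (fun s hs => (hfneg s hs).le) (fun s hs => (hgneg s hs).le),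
    holder_of_nonpos hf₁ hg₁ (fun s hs => (hfle s hs).trans (hfneg s hs).le)
      (fun s hs => (hgle s hs).trans (hgneg s hs).le)⟩
end
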